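/- arXiv:1104.1182 — 2 statements merged into one kernel-verified Lean document; each statement's English description precedes it below -/
import Mathlib

section
/- Suppose f is a weakly holomorphic modular function for a level-N congruence subgroup Γ ≤ SL₂(ℤ) such that for every γ ∈ SL₂(ℤ) the Fourier expansion of f|γ at infinity has coefficients in ℤ[ζ_N]. If τ₀ ∈ H is a CM point (a root of an integral quadratic polynomial with negative discriminant), then f(τ₀) is an algebraic integer whose degree over ℚ(ζ_N, j(τ₀)) is at most [SL₂(ℤ) : Γ]. -/
noncomputable section

open Complex

/-- The Möbius action of an integral matrix on `ℂ`. -/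
def moebiusZ (g : Matrix.SpecialLinearGroup (Fin 2) ℤ) (z : ℂ) : ℂ :=
  (((g : Matrix (Fin 2) (Fin 2) ℤ) 0 0 : ℂ) * z + ((g : Matrix (Fin 2) (Fin 2) ℤ) 0 1 : ℂ))
    / (((g : Matrix (Fin 2) (Fin 2) ℤ) 1 0 : ℂ) * z + ((g : Matrix (Fin 2) (Fin 2) ℤ) 1 1 : ℂ))

/-- The nome `q = e^{2πiz}`. -/
def nome (z : ℂ) : ℂ := Complex.exp (2 * Real.pi * Complex.I * z)

/-- Klein's `j`-invariant, `j = E₄³/Δ`. -/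
def jInv (z : ℂ) : ℂ :=
  (1 + 240 * ∑' n : ℕ, (((n + 1 : ℕ).divisors.sum fun d => (d : ℂ) ^ 3)) * nome z ^ (n + 1)) ^ 3
    / (nome z * ∏' n : ℕ, (1 - nome z ^ (n + 1)) ^ 24)

section DiscSeries

open Finset.HasAntidiagonal

lemma hasSum_cauchyProduct {a b : ℕ → ℂ} {q s t : ℂ} (ha : HasSum (fun n ↦ a n * q ^ n) s)
    (hb : HasSum (fun n ↦ b n * q ^ n) t) :
    HasSum (fun n ↦ (∑ kl ∈ antidiagonal n, a kl.1 * b kl.2) * q ^ n) (s * t) := by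
  have hcongr : (fun n ↦ (∑ kl ∈ antidiagonal n, a kl.1 * b kl.2) * q ^ n) =
      fun n ↦ ∑ kl ∈ antidiagonal n, (a kl.1 * q ^ kl.1) * (b kl.2 * q ^ kl.2) := by
    funext n
    rw [Finset.sum_mul]
    refine Finset.sum_congr rfl fun kl hkl ↦ ?_
    rw [← Finset.HasAntidiagonal.mem_antidiagonal.mp hkl, pow_add]
    ring
  rw [hcongr, ← ha.tsum_eq, ← hb.tsum_eq,
    tsum_mul_tsum_eq_tsum_sum_antidiagonal_of_summable_norm ha.summable.norm hb.summable.norm]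
  exact (summable_norm_sum_mul_antidiagonal_of_summable_norm ha.summable.norm
    hb.summable.norm).of_norm.hasSum

/-- Functions given on the open unit disc by a power series with coefficients in `R`. -/
def discSeries (R : Subring ℂ) : Subring (ℂ → ℂ) where
  carrier := {g | ∃ a : ℕ → ℂ, (∀ n, a n ∈ R) ∧
    ∀ q : ℂ, ‖q‖ < 1 → HasSum (fun n ↦ a n * q ^ n) (g q)}
  mul_mem' := by
    rintro g h ⟨a, haR, ha⟩ ⟨b, hbR, hb⟩
    refine ⟨fun n ↦ ∑ kl ∈ antidiagonal n, a kl.1 * b kl.2,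
      fun n ↦ sum_mem fun kl _ ↦ mul_mem (haR _) (hbR _), fun q hq ↦ ?_⟩
    exact hasSum_cauchyProduct (ha q hq) (hb q hq)
  one_mem' := by
    refine ⟨fun n ↦ if n = 0 then 1 else 0, fun n ↦ ?_, fun q _ ↦ ?_⟩
    · dsimp only
      split_ifs <;> simp
    · rw [Pi.one_apply]
      convert hasSum_ite_eq 0 (1 : ℂ) using 2 with n
      rcases eq_or_ne n 0 with rfl | hn <;> simp [*]
  add_mem' := by
    rintro g h ⟨a, haR, ha⟩ ⟨b, hbR, hb⟩
    refine ⟨fun n ↦ a n + b n, fun n ↦ add_mem (haR n) (hbR n), fun q hq ↦ ?_⟩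
    simpa only [add_mul, Pi.add_apply] using (ha q hq).add (hb q hq)
  zero_mem' := ⟨0, fun _ ↦ R.zero_mem, fun q _ ↦ by simp⟩
  neg_mem' := by
    rintro g ⟨a, haR, ha⟩
    refine ⟨fun n ↦ -a n, fun n ↦ neg_mem (haR n), fun q hq ↦ ?_⟩
    simpa only [neg_mul, Pi.neg_apply] using (ha q hq).neg

namespace discSeries

variable {R : Subring ℂ} {g : ℂ → ℂ}

lemma mono {S : Subring ℂ} (hRS : R ≤ S) (hg : g ∈ discSeries R) : g ∈ discSeries S :=
  let ⟨a, haR, ha⟩ := hg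
  ⟨a, fun n ↦ hRS (haR n), ha⟩

lemma const_mem {c : ℂ} (hc : c ∈ R) : (fun _ ↦ c) ∈ discSeries R := by
  refine ⟨fun n ↦ if n = 0 then c else 0, fun n ↦ ?_, fun q _ ↦ ?_⟩
  · dsimp only
    split_ifs
    exacts [hc, R.zero_mem]
  · convert hasSum_ite_eq 0 c using 2 with n
    rcases eq_or_ne n 0 with rfl | hn <;> simp [*]

lemma id_mem : (fun q ↦ q) ∈ discSeries R := by
  refine ⟨fun n ↦ if n = 1 then 1 else 0, fun n ↦ ?_, fun q _ ↦ ?_⟩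
  · dsimp only
    split_ifs <;> simp
  · convert hasSum_ite_eq 1 q using 2 with n
    rcases eq_or_ne n 1 with rfl | hn <;> simp [*]

lemma pow_mem (k : ℕ) : (fun q ↦ q ^ k) ∈ discSeries R :=
  Subring.pow_mem _ id_mem k

lemma apply_zero_eq {a : ℕ → ℂ} (ha : ∀ q : ℂ, ‖q‖ < 1 → HasSum (fun n ↦ a n * q ^ n) (g q)) :
    g 0 = a 0 := by
  refine (ha 0 (by simp)).unique ?_
  convert hasSum_ite_eq 0 (a 0) using 2 with n
  rcases eq_or_ne n 0 with rfl | hn <;> simp [*]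

lemma apply_zero_mem (hg : g ∈ discSeries R) : g 0 ∈ R := by
  obtain ⟨a, haR, ha⟩ := hg
  exact apply_zero_eq ha ▸ haR 0

lemma exists_eq_mul (hg : g ∈ discSeries R) (h0 : g 0 = 0) :
    ∃ h ∈ discSeries R, ∀ q : ℂ, ‖q‖ < 1 → g q = q * h q := by
  obtain ⟨a, haR, ha⟩ := hg
  have ha0 : a 0 = 0 := (apply_zero_eq ha).symm.trans h0
  have key : ∀ q : ℂ, ‖q‖ < 1 → HasSum (fun n ↦ a (n + 1) * q ^ (n + 1)) (g q) := fun q hq ↦ by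
    simpa [ha0] using (hasSum_nat_add_iff' 1).mpr (ha q hq)
  refine ⟨fun q ↦ if q = 0 then a 1 else q⁻¹ * g q, ⟨fun n ↦ a (n + 1), fun n ↦ haR _, ?_⟩, ?_⟩
  · intro q hq
    rcases eq_or_ne q 0 with rfl | hq0
    · simp only [if_true]
      convert hasSum_ite_eq 0 (a 1) using 2 with n
      rcases eq_or_ne n 0 with rfl | hn <;> simp [*]
    · simp only [if_neg hq0]
      refine ((key q hq).mul_left q⁻¹).congr_fun fun n ↦ ?_
      field_simp
      ring
  · intro q hq
    rcases eq_or_ne q 0 with rfl | hq0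
    · simp [h0]
    · simp [hq0]

lemma comp_mul_pow_mem (hg : g ∈ discSeries R) {c : ℂ} (hcR : c ∈ R) (hc : ‖c‖ = 1) {k : ℕ}
    (hk : k ≠ 0) : (fun q ↦ g (c * q ^ k)) ∈ discSeries R := by
  obtain ⟨a, haR, ha⟩ := hg
  have hinj : Function.Injective fun n : ℕ ↦ k * n := mul_right_injective₀ hk
  refine ⟨Function.extend (fun n : ℕ ↦ k * n) (fun n ↦ a n * c ^ n) 0, fun n ↦ ?_, fun q hq ↦ ?_⟩
  · by_cases h : ∃ m, k * m = n
    · obtain ⟨m, rfl⟩ := h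
      rw [hinj.extend_apply (f := fun n : ℕ ↦ k * n)]
      exact mul_mem (haR m) (Subring.pow_mem _ hcR m)
    · rw [Function.extend_apply' _ _ _ h]
      exact R.zero_mem
  · have hlt : ‖c * q ^ k‖ < 1 := by
      simpa [hc] using pow_lt_one₀ (norm_nonneg q) hq hk
    rw [← hinj.hasSum_iff]
    · refine (ha _ hlt).congr_fun fun n ↦ ?_
      rw [Function.comp_apply, hinj.extend_apply (f := fun n : ℕ ↦ k * n), mul_pow, pow_mul]
      ring
    · intro n hn
      rw [Function.extend_apply' _ _ _ (by simpa using hn)]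
      simp

lemma hasFPowerSeriesOnBall {a : ℕ → ℂ}
    (ha : ∀ q : ℂ, ‖q‖ < 1 → HasSum (fun n ↦ a n * q ^ n) (g q)) :
    HasFPowerSeriesOnBall g (.ofScalars ℂ a) 0 1 where
  r_le := by
    refine le_of_forall_lt_imp_le_of_dense fun r hr ↦ ?_
    lift r to NNReal using hr.ne_top
    apply FormalMultilinearSeries.le_radius_of_summable
    simpa [mul_comm] using (ha r (by simpa using hr)).summable.norm
  r_pos := by simp
  hasSum {y} hy := by
    rw [← ENNReal.coe_one, Metric.eball_coe, NNReal.coe_one, mem_ball_zero_iff] at hy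
    simpa [mul_comm] using ha y hy

lemma differentiableOn (hg : g ∈ discSeries R) : DifferentiableOn ℂ g (Metric.ball 0 1) := by
  obtain ⟨a, -, ha⟩ := hg
  have := (hasFPowerSeriesOnBall ha).differentiableOn
  rwa [← ENNReal.coe_one, Metric.eball_coe, NNReal.coe_one] at this

lemma tendsto_zero (hg : g ∈ discSeries R) : Filter.Tendsto g (nhds 0) (nhds (g 0)) :=
  ((differentiableOn hg).differentiableAt (Metric.ball_mem_nhds 0 one_pos)).continuousAt

lemma coeff_unique {a b : ℕ → ℂ} (ha : ∀ q : ℂ, ‖q‖ < 1 → HasSum (fun n ↦ a n * q ^ n) (g q))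
    (hb : ∀ q : ℂ, ‖q‖ < 1 → HasSum (fun n ↦ b n * q ^ n) (g q)) : a = b := by
  funext n
  simpa using congr_arg (FormalMultilinearSeries.coeff · n)
    ((hasFPowerSeriesOnBall ha).hasFPowerSeriesAt.eq_formalMultilinearSeries
      (hasFPowerSeriesOnBall hb).hasFPowerSeriesAt)

lemma hasSum_taylor (hg : DifferentiableOn ℂ g (Metric.ball 0 1)) {q : ℂ} (hq : ‖q‖ < 1) :
    HasSum (fun n ↦ (n.factorial : ℂ)⁻¹ * iteratedDeriv n g 0 * q ^ n) (g q) := by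
  refine (Complex.hasSum_taylorSeries_on_ball hg (z := q) (by simpa using hq)).congr_fun fun n ↦ ?_
  simp only [sub_zero, smul_eq_mul]
  ring

lemma inv_mem (hg : g ∈ discSeries R) (hne : ∀ q, ‖q‖ < 1 → g q ≠ 0) (h0 : (g 0)⁻¹ ∈ R) :
    (fun q ↦ (g q)⁻¹) ∈ discSeries R := by
  have hdiff := (differentiableOn hg).fun_inv fun q hq ↦ hne q (by simpa using hq)
  have hT : (fun q ↦ (g q)⁻¹) ∈ discSeries (⊤ : Subring ℂ) :=
    ⟨_, fun _ ↦ Subring.mem_top _, fun q hq ↦ hasSum_taylor hdiff hq⟩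
  obtain ⟨b, -, hb⟩ := hT
  obtain ⟨a, haR, ha⟩ := hg
  refine ⟨b, fun n ↦ ?_, hb⟩
  have hprod : ∀ q : ℂ, ‖q‖ < 1 → HasSum
      (fun n ↦ (∑ kl ∈ antidiagonal n, a kl.1 * b kl.2) * q ^ n) 1 := fun q hq ↦ by
    simpa [hne q hq] using hasSum_cauchyProduct (ha q hq) (hb q hq)
  have hone : ∀ q : ℂ, ‖q‖ < 1 → HasSum (fun n ↦ (if n = 0 then 1 else 0) * q ^ n) (1 : ℂ) :=
    fun q _ ↦ by
      convert hasSum_ite_eq 0 (1 : ℂ) using 2 with n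
      rcases eq_or_ne n 0 with rfl | hn <;> simp [*]
  have hcoeff := coeff_unique (g := 1) hprod hone
  have ha0 : g 0 = a 0 := apply_zero_eq ha
  have ha0' : a 0 ≠ 0 := ha0 ▸ hne 0 (by simp)
  rw [ha0] at h0
  induction n using Nat.strong_induction_on with
  | _ n ih =>
    have hn := congr_fun hcoeff n
    rw [Finset.Nat.sum_antidiagonal_eq_sum_range_succ_mk, Finset.sum_range_succ'] at hn
    have hbn : b n = (a 0)⁻¹ * ((if n = 0 then 1 else 0) -
        ∑ k ∈ Finset.range n, a (k + 1) * b (n - (k + 1))) := by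
      rw [← hn]
      field_simp
      simp [mul_comm]
    rw [hbn]
    refine mul_mem h0 (sub_mem ?_ (sum_mem fun k hk ↦ mul_mem (haR _) (ih _ ?_)))
    · split_ifs <;> simp
    · have := Finset.mem_range.mp hk
      omega

lemma tendstoLocallyUniformlyOn_iteratedDeriv {U : Set ℂ} (hU : IsOpen U) {F : ℕ → ℂ → ℂ}
    (hF : ∀ n, DifferentiableOn ℂ (F n) U)
    (hlim : TendstoLocallyUniformlyOn F g Filter.atTop U) (k : ℕ) :
    TendstoLocallyUniformlyOn (fun n ↦ iteratedDeriv k (F n)) (iteratedDeriv k g)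
      Filter.atTop U := by
  have hdiff (k n : ℕ) : DifferentiableOn ℂ (iteratedDeriv k (F n)) U := by
    induction k with
    | zero => simpa using hF n
    | succ k ih => simpa only [iteratedDeriv_succ] using ih.deriv hU
  induction k with
  | zero => simpa using hlim
  | succ k ih =>
    simp only [iteratedDeriv_succ]
    exact ih.deriv (.of_forall (hdiff k)) hU

/-- A locally uniform limit of integral power series is an integral power series. -/
lemma mem_of_tendstoLocallyUniformlyOn {F : ℕ → ℂ → ℂ}
    (hF : ∀ n, F n ∈ discSeries (⊥ : Subring ℂ))
    (hlim : TendstoLocallyUniformlyOn F g Filter.atTop (Metric.ball 0 1)) :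
    g ∈ discSeries (⊥ : Subring ℂ) := by
  have hdiff := hlim.differentiableOn (.of_forall fun n ↦ differentiableOn (hF n))
    Metric.isOpen_ball
  refine ⟨_, fun k ↦ ?_, fun q hq ↦ hasSum_taylor hdiff hq⟩
  have hclosed : IsClosed ((⊥ : Subring ℂ) : Set ℂ) := by
    have : ((⊥ : Subring ℂ) : Set ℂ) = Set.range ((↑) : ℤ → ℂ) := by
      ext
      simp [Subring.mem_bot]
    exact this ▸ Complex.isClosedEmbedding_intCast.isClosed_range
  refine hclosed.mem_of_tendsto (f := fun n ↦ (k.factorial : ℂ)⁻¹ * iteratedDeriv k (F n) 0)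
    (b := Filter.atTop) (((tendstoLocallyUniformlyOn_iteratedDeriv Metric.isOpen_ball
      (fun n ↦ differentiableOn (hF n)) hlim k).tendsto_at (by simp)).const_mul _)
    (.of_forall fun n ↦ ?_)
  obtain ⟨a, haR, ha⟩ := hF n
  rw [show (k.factorial : ℂ)⁻¹ * iteratedDeriv k (F n) 0 = a k from
    congr_fun (coeff_unique (fun q hq ↦ hasSum_taylor (differentiableOn (hF n)) hq) ha) k]
  exact haR k

lemma tprod_one_sub_pow_mem : (fun q ↦ ∏' n : ℕ, (1 - q ^ (n + 1))) ∈ discSeries R := by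
  refine mono bot_le (mem_of_tendstoLocallyUniformlyOn
    (F := fun M q ↦ ∏ n ∈ Finset.range M, (1 - q ^ (n + 1))) (fun M ↦ ?_) ?_)
  · have := prod_mem (S := discSeries (⊥ : Subring ℂ)) (t := Finset.range M)
      (f := fun n ↦ fun q ↦ 1 - q ^ (n + 1)) fun n _ ↦ sub_mem (one_mem _) (pow_mem (n + 1))
    convert this using 1
    ext q
    simp
  · exact ModularForm.multipliableLocallyUniformlyOn_one_sub_pow.hasProdLocallyUniformlyOn
      |>.tendstoLocallyUniformlyOn_finsetRange

end discSeries

end DiscSeries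

section KleinJ

open UpperHalfPlane ModularForm MatrixGroups Function.Periodic
open scoped ArithmeticFunction.sigma

/-- The power series with constant term `1` that satisfies `q * j = jSeries q`. -/
def jSeries (q : ℂ) : ℂ :=
  (1 + 240 * ∑' n : ℕ, (((n + 1 : ℕ).divisors.sum fun d => (d : ℂ) ^ 3)) * q ^ (n + 1)) ^ 3
    * ((∏' n : ℕ, (1 - q ^ (n + 1))) ^ 24)⁻¹

lemma tprod_one_sub_pow_ne_zero {q : ℂ} (hq : ‖q‖ < 1) : ∏' n : ℕ, (1 - q ^ (n + 1)) ≠ 0 := by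
  refine tprod_one_add_ne_zero_of_summable (f := fun n ↦ -q ^ (n + 1)) (fun n h ↦ ?_) ?_
  · have h1 : q ^ (n + 1) = 1 := by linear_combination -h
    have h2 := congr_arg norm h1
    rw [norm_pow, norm_one] at h2
    exact (pow_lt_one₀ (norm_nonneg q) hq n.succ_ne_zero).ne h2
  · simpa using (summable_nat_add_iff 1).mpr (summable_geometric_of_lt_one (norm_nonneg q) hq)

lemma summable_sum_divisors_mul_pow {q : ℂ} (hq : ‖q‖ < 1) :
    Summable fun n : ℕ ↦ (n.divisors.sum fun d => (d : ℂ) ^ 3) * q ^ n := by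
  refine .of_norm_bounded (summable_norm_pow_mul_geometric_of_norm_lt_one 4 hq) fun n ↦ ?_
  have : (n.divisors.sum fun d => (d : ℂ) ^ 3) = (σ 3 n : ℂ) := by
    simp [ArithmeticFunction.sigma_apply]
  rw [this, norm_mul, norm_mul, norm_natCast, norm_pow, norm_pow, norm_natCast]
  gcongr
  exact_mod_cast ArithmeticFunction.sigma_le_pow_succ 3 n

lemma jSeries_mem (R : Subring ℂ) : jSeries ∈ discSeries R := by
  have hE : (fun q : ℂ ↦ ∑' n : ℕ, (((n + 1 : ℕ).divisors.sum fun d => (d : ℂ) ^ 3)) * q ^ (n + 1))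
      ∈ discSeries R := by
    refine ⟨fun n ↦ n.divisors.sum fun d => (d : ℂ) ^ 3,
      fun n ↦ sum_mem fun d _ ↦ Subring.pow_mem _ (natCast_mem R d) 3, fun q hq ↦ ?_⟩
    have h := summable_sum_divisors_mul_pow hq
    rw [← hasSum_nat_add_iff' 1]
    simpa using ((summable_nat_add_iff 1).mpr h).hasSum
  have hη : (fun q : ℂ ↦ (∏' n : ℕ, (1 - q ^ (n + 1))) ^ 24) ∈ discSeries R :=
    Subring.pow_mem _ discSeries.tprod_one_sub_pow_mem 24
  exact mul_mem (Subring.pow_mem _ (add_mem (one_mem _)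
      (mul_mem (discSeries.const_mem (ofNat_mem R 240)) hE)) 3)
    (discSeries.inv_mem hη (fun q hq ↦ pow_ne_zero _ (tprod_one_sub_pow_ne_zero hq)) (by simp))

lemma jSeries_zero : jSeries 0 = 1 := by
  simp [jSeries]

lemma nome_eq_qParam (z : ℂ) : nome z = qParam 1 z := by
  simp [nome, qParam]

lemma jInv_mul_qParam (z : ℍ) : jInv z * qParam 1 z = jSeries (qParam 1 z) := by
  have hq : ‖qParam 1 z‖ < 1 := Function.Periodic.norm_qParam_lt_one one_pos z.2
  rw [jInv, jSeries, nome_eq_qParam, (multipliable_one_sub_pow hq).tprod_pow]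
  have h1 := tprod_one_sub_pow_ne_zero hq
  have h2 := qParam_ne_zero (h := 1) z
  field_simp

lemma jInv_eq_E₄_pow_div_discriminant (z : ℍ) : jInv z = E₄ z ^ 3 / discriminant z := by
  rw [jInv, discriminant_eq_q_prod, nome_eq_qParam]
  congr 2
  · rw [EisensteinSeries.q_expansion_bernoulli _ ⟨2, rfl⟩,
      show bernoulli 4 = -1 / 30 by norm_num [bernoulli],
      tsum_pnat_eq_tsum_succ (f := fun n ↦
        (σ (4 - 1) n : ℂ) * cexp (2 * Real.pi * Complex.I * z) ^ (n : ℤ))]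
    norm_num [ArithmeticFunction.sigma_apply, qParam]
    norm_cast

lemma jInv_smul (γ : SL(2, ℤ)) (z : ℍ) : jInv ↑(γ • z) = jInv z := by
  have hE : E₄ (γ • z) = denom γ z ^ (4 : ℤ) * E₄ z :=
    SlashInvariantForm.slash_action_eqn'' E₄ (MonoidHom.mem_range.mpr ⟨γ, rfl⟩) z
  have hD : discriminant ↑(γ • z) = denom γ z ^ (12 : ℤ) * discriminant z :=
    SlashInvariantForm.slash_action_eqn'' CuspForm.discriminant
      (MonoidHom.mem_range.mpr ⟨γ, rfl⟩) z
  have hd := discriminant_ne_zero z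
  have hz := denom_ne_zero γ z
  rw [jInv_eq_E₄_pow_div_discriminant, jInv_eq_E₄_pow_div_discriminant, hE, hD]
  rw [mul_pow, ← zpow_natCast, ← zpow_mul]
  exact mul_div_mul_left _ _ (zpow_ne_zero _ hz)

end KleinJ

section Puiseux

open UpperHalfPlane ModularForm MatrixGroups Function.Periodic Polynomial

/-- Functions on the upper half-plane with an expansion in integral powers of
`exp (2πiz / N)`, bounded below, with coefficients in `R`. -/
def puiseux (R : Subring ℂ) (N : ℕ) : Subring (ℍ → ℂ) where
  carrier := {F | ∃ n : ℕ, ∃ g ∈ discSeries R, ∀ z : ℍ,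
    F z * qParam N z ^ n = g (qParam N z)}
  mul_mem' := by
    rintro F G ⟨n, g, hg, hF⟩ ⟨m, h, hh, hG⟩
    refine ⟨n + m, g * h, mul_mem hg hh, fun z ↦ ?_⟩
    rw [Pi.mul_apply, Pi.mul_apply, ← hF, ← hG]
    ring
  one_mem' := ⟨0, 1, one_mem _, fun z ↦ by simp⟩
  add_mem' := by
    rintro F G ⟨n, g, hg, hF⟩ ⟨m, h, hh, hG⟩
    refine ⟨n + m, g * (fun q ↦ q ^ m) + h * (fun q ↦ q ^ n),
      add_mem (mul_mem hg (discSeries.pow_mem m)) (mul_mem hh (discSeries.pow_mem n)),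
      fun z ↦ ?_⟩
    simp only [Pi.mul_apply, Pi.add_apply, ← hF, ← hG]
    ring
  zero_mem' := ⟨0, 0, zero_mem _, fun z ↦ by simp⟩
  neg_mem' := by
    rintro F ⟨n, g, hg, hF⟩
    refine ⟨n, -g, neg_mem hg, fun z ↦ ?_⟩
    rw [Pi.neg_apply, Pi.neg_apply, ← hF]
    ring

/-- The elements of `puiseux R N` whose leading coefficient is a unit of `R`. -/
def unitPuiseux (R : Subring ℂ) (N : ℕ) : Submonoid (ℍ → ℂ) where
  carrier := {F | ∃ n : ℕ, ∃ g ∈ discSeries R, g 0 ≠ 0 ∧ (g 0)⁻¹ ∈ R ∧ ∀ z : ℍ,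
    F z * qParam N z ^ n = g (qParam N z)}
  mul_mem' := by
    rintro F G ⟨n, g, hg, hg0, hgR, hF⟩ ⟨m, h, hh, hh0, hhR, hG⟩
    refine ⟨n + m, g * h, mul_mem hg hh, mul_ne_zero hg0 hh0, ?_, fun z ↦ ?_⟩
    · rw [Pi.mul_apply, mul_inv]
      exact mul_mem hgR hhR
    · rw [Pi.mul_apply, Pi.mul_apply, ← hF, ← hG]
      ring
  one_mem' := ⟨0, 1, one_mem _, one_ne_zero, by simp, fun z ↦ by simp⟩

variable {R : Subring ℂ} {N : ℕ} {F : ℍ → ℂ} {g : ℂ → ℂ}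

lemma exists_eq_const_of_eq_discSeries (hN : N ≠ 0)
    (hinv : ∀ (γ : SL(2, ℤ)) (z : ℍ), F (γ • z) = F z) (hg : g ∈ discSeries R)
    (hFg : ∀ z : ℍ, F z = g (qParam N z)) (z : ℍ) : F z = g 0 := by
  have hN' : (0 : ℝ) < N := by positivity
  have hslash (γ : SL(2, ℤ)) : F ∣[(0 : ℤ)] γ = F := by
    ext z
    rw [ModularForm.SL_slash_apply, hinv]
    simp
  have hlim : Filter.Tendsto F atImInfty (nhds (g 0)) := by
    rw [funext hFg]
    exact (discSeries.tendsto_zero hg).comp (qParam_tendsto_atImInfty hN')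
  let Φ : ModularForm 𝒮ℒ 0 :=
    { toFun := F
      slash_action_eq' := by
        rintro _ ⟨γ, rfl⟩
        exact hslash γ
      holo' := by
        rw [UpperHalfPlane.mdifferentiable_iff]
        have hcomp : DifferentiableOn ℂ (fun z ↦ g (qParam N z)) {z | 0 < z.im} :=
          (discSeries.differentiableOn hg).comp (by fun_prop) fun z hz ↦ by
            simpa using norm_qParam_lt_one hN' hz
        refine hcomp.congr fun z hz ↦ ?_
        simp [hFg, ofComplex_apply_of_im_pos hz]
      bdd_at_cusps' := by
        intro c hc
        rw [Subgroup.IsArithmetic.isCusp_iff_isCusp_SL2Z] at hc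
        rw [OnePoint.isBoundedAt_iff_forall_SL2Z hc]
        intro γ _
        rw [hslash]
        exact hlim.isBigO_one ℝ }
  obtain ⟨c, hc⟩ := ModularFormClass.levelOne_weight_zero_const Φ
  have hc' : F = Function.const _ c := hc
  rw [hc'] at hlim
  rw [hc']
  exact tendsto_nhds_unique tendsto_const_nhds hlim

lemma dvd_of_mul_qParam_pow_eq (hN : N ≠ 0)
    (hinv : ∀ (γ : SL(2, ℤ)) (z : ℍ), F (γ • z) = F z) (hg : g ∈ discSeries R) (hg0 : g 0 ≠ 0)
    {n : ℕ} (hFg : ∀ z : ℍ, F z * qParam N z ^ n = g (qParam N z)) : N ∣ n := by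
  have hN' : (0 : ℝ) < N := by positivity
  set ω : ℂ := Complex.exp (2 * Real.pi * Complex.I / N)
  have hω : IsPrimitiveRoot ω N := Complex.isPrimitiveRoot_exp N hN
  have hT (z : ℍ) : qParam N ↑(ModularGroup.T • z) = ω * qParam N z := by
    rw [modular_T_smul, coe_vadd, qParam, qParam, ← Complex.exp_add]
    congr 1
    push_cast
    ring
  have key (z : ℍ) : g (ω * qParam N z) = ω ^ n * g (qParam N z) := by
    rw [← hT, ← hFg, ← hFg, hinv, hT]
    ring
  have hq := qParam_tendsto_atImInfty hN'
  have h1 : Filter.Tendsto (fun z : ℍ ↦ g (ω * qParam N z)) atImInfty (nhds (g 0)) := by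
    refine (discSeries.tendsto_zero hg).comp ?_
    simpa using hq.const_mul ω
  have h2 : Filter.Tendsto (fun z : ℍ ↦ ω ^ n * g (qParam N z)) atImInfty
      (nhds (ω ^ n * g 0)) := ((discSeries.tendsto_zero hg).comp hq).const_mul _
  rw [← funext key] at h2
  have h3 := tendsto_nhds_unique h1 h2
  rw [← hω.pow_eq_one_iff_dvd]
  exact mul_right_cancel₀ hg0 (by rw [← h3, one_mul])

lemma qParam_natCast_pow (hN : N ≠ 0) (z : ℂ) : qParam N z ^ N = qParam 1 z := by
  rw [qParam, qParam, ← Complex.exp_nat_mul]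
  congr 1
  push_cast
  field_simp

/-- The `q`-expansion principle: a modular function for `SL(2, ℤ)` with a pole of order at most
`n` in `exp (2πiz / N)` and coefficients in `R` is a polynomial in `j` over `R`. -/
theorem exists_eq_aeval_jInv (hN : N ≠ 0) (n : ℕ) :
    ∀ (F : ℍ → ℂ) (g : ℂ → ℂ), (∀ (γ : SL(2, ℤ)) (z : ℍ), F (γ • z) = F z) →
      g ∈ discSeries R → (∀ z : ℍ, F z * qParam N z ^ n = g (qParam N z)) →
      ∃ P : R[X], N * P.natDegree ≤ n ∧ (g 0 ≠ 0 → (P.leadingCoeff : ℂ) = g 0) ∧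
        ∀ z : ℍ, F z = aeval (jInv z) P := by
  have hN' : (0 : ℝ) < N := by positivity
  induction n with
  | zero =>
    intro F g hinv hg hFg
    refine ⟨C ⟨g 0, discSeries.apply_zero_mem hg⟩, by simp, fun _ ↦ by simp, fun z ↦ ?_⟩
    rw [exists_eq_const_of_eq_discSeries hN hinv hg (by simpa using hFg) z, aeval_C]
    rfl
  | succ n ih =>
    intro F g hinv hg hFg
    have descend (F : ℍ → ℂ) (g : ℂ → ℂ) (hinv : ∀ (γ : SL(2, ℤ)) (z : ℍ), F (γ • z) = F z)
        (hg : g ∈ discSeries R) (hg0 : g 0 = 0)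
        (hFg : ∀ z : ℍ, F z * qParam N z ^ (n + 1) = g (qParam N z)) :
        ∃ P : R[X], N * P.natDegree ≤ n ∧ ∀ z : ℍ, F z = aeval (jInv z) P := by
      obtain ⟨h, hh, hgh⟩ := discSeries.exists_eq_mul hg hg0
      obtain ⟨P, hP, -, hFP⟩ := ih F h hinv hh fun z ↦
        mul_left_cancel₀ (qParam_ne_zero (h := N) z) <| by
          rw [← hgh _ (norm_qParam_lt_one hN' z.2), ← hFg]
          ring
      exact ⟨P, hP, hFP⟩
    by_cases hg0 : g 0 = 0
    · obtain ⟨P, hP, hFP⟩ := descend F g hinv hg hg0 hFg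
      exact ⟨P, hP.trans n.le_succ, fun h ↦ absurd hg0 h, hFP⟩
    obtain ⟨K, hK⟩ := dvd_of_mul_qParam_pow_eq hN hinv hg hg0 hFg
    let c : R := ⟨g 0, discSeries.apply_zero_mem hg⟩
    have hc : c ≠ 0 := fun h ↦ hg0 (congr_arg Subtype.val h)
    obtain ⟨P, hP, hFP⟩ := descend (fun z ↦ F z - g 0 * jInv z ^ K)
      (g - (fun _ ↦ g 0) * (fun q ↦ jSeries (1 * q ^ N)) ^ K)
      (fun γ z ↦ by rw [hinv, jInv_smul])
      (sub_mem hg (mul_mem (discSeries.const_mem (discSeries.apply_zero_mem hg))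
        (Subring.pow_mem _ (discSeries.comp_mul_pow_mem (jSeries_mem R) (one_mem R) (by simp) hN)
          K)))
      (by simp [hN, jSeries_zero])
      (fun z ↦ by
        simp only [Pi.sub_apply, Pi.mul_apply, Pi.pow_apply, one_mul, qParam_natCast_pow hN,
          ← jInv_mul_qParam, ← hFg]
        rw [mul_pow, ← qParam_natCast_pow hN, ← pow_mul, hK]
        ring)
    have hdeg : P.degree < (C c * X ^ K).degree := by
      rw [degree_C_mul_X_pow K hc]
      refine degree_le_natDegree.trans_lt ?_
      have : N * P.natDegree < N * K := by omega
      exact_mod_cast lt_of_mul_lt_mul_left' this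
    refine ⟨P + C c * X ^ K, ?_, fun _ ↦ ?_, fun z ↦ ?_⟩
    · rw [natDegree_add_eq_right_of_degree_lt hdeg, natDegree_C_mul_X_pow K c hc, hK]
    · rw [leadingCoeff_add_of_degree_lt hdeg, leadingCoeff_C_mul_X_pow]
    · have := hFP z
      rw [map_add, ← this, map_mul, aeval_C, map_pow, aeval_X]
      change F z = F z - g 0 * jInv z ^ K + g 0 * jInv z ^ K
      ring

end Puiseux

section Orbit

open UpperHalfPlane MatrixGroups

/-- Precomposition with the Möbius action as a ring homomorphism. -/
def precompSL (γ : SL(2, ℤ)) : (ℍ → ℂ) →+* (ℍ → ℂ) :=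
  RingHom.pi fun z ↦ Pi.evalRingHom (fun _ ↦ ℂ) (γ • z)

@[simp]
lemma precompSL_apply (γ : SL(2, ℤ)) (F : ℍ → ℂ) (z : ℍ) : precompSL γ F z = F (γ • z) := rfl

lemma precompSL_injective (γ : SL(2, ℤ)) : Function.Injective (precompSL γ) := fun F G h ↦ by
  funext z
  simpa using congr_fun h (γ⁻¹ • z)

lemma prod_precompSL {M : Type*} [CommMonoid M] {s : Finset (ℍ → ℂ)}
    (hs : ∀ F ∈ s, ∀ γ, precompSL γ F ∈ s) (γ : SL(2, ℤ)) (φ : (ℍ → ℂ) → M) :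
    ∏ F ∈ s, φ (precompSL γ F) = ∏ F ∈ s, φ F := by
  refine Finset.prod_nbij (precompSL γ) (fun F hF ↦ hs F hF γ)
    (precompSL_injective γ).injOn (fun F hF ↦ ⟨precompSL γ⁻¹ F, hs F hF _, ?_⟩) fun _ _ ↦ rfl
  funext z
  simp

end Orbit

section Singular

open UpperHalfPlane MatrixGroups Function.Periodic Polynomial FixedDetMatrices

/-- The invertible real matrix underlying an integral matrix of determinant `m ≠ 0`. -/
def fixedDetToGL {m : ℕ} (hm : m ≠ 0) (A : FixedDetMatrix (Fin 2) ℤ m) : GL (Fin 2) ℝ :=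
  .mkOfDetNeZero (A.1.map (Int.castRingHom ℝ)) <| by
    rw [← RingHom.mapMatrix_apply, ← RingHom.map_det, A.2]
    simpa using hm

variable {m : ℕ} (hm : m ≠ 0)

lemma fixedDetToGL_smul (γ : SL(2, ℤ)) (A : FixedDetMatrix (Fin 2) ℤ m) (z : ℍ) :
    fixedDetToGL hm (γ • A) • z = γ • fixedDetToGL hm A • z := by
  have : fixedDetToGL hm (γ • A) = Matrix.SpecialLinearGroup.mapGL ℝ γ * fixedDetToGL hm A := by
    apply Units.ext
    exact Matrix.map_mul
  rw [this, mul_smul]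
  rfl

lemma coe_fixedDetToGL_smul (A : FixedDetMatrix (Fin 2) ℤ m) (z : ℍ) :
    ((fixedDetToGL hm A • z : ℍ) : ℂ) = (A.1 0 0 * z + A.1 0 1) / (A.1 1 0 * z + A.1 1 1) := by
  have hdet : 0 < (fixedDetToGL hm A).det.val := by
    change 0 < (A.1.map (Int.castRingHom ℝ)).det
    rw [← RingHom.mapMatrix_apply, ← RingHom.map_det, A.2]
    simpa using Nat.pos_of_ne_zero hm
  rw [coe_smul_of_det_pos hdet]
  change (((A.1 0 0 : ℝ) : ℂ) * z + ((A.1 0 1 : ℝ) : ℂ)) /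
    (((A.1 1 0 : ℝ) : ℂ) * z + ((A.1 1 1 : ℝ) : ℂ)) = _
  push_cast
  rfl

/-- The function `j ∘ A` for an integral matrix `A` of determinant `m`. -/
def jComp (A : FixedDetMatrix (Fin 2) ℤ m) (z : ℍ) : ℂ := jInv ↑(fixedDetToGL hm A • z)

lemma jComp_smul (γ : SL(2, ℤ)) (A : FixedDetMatrix (Fin 2) ℤ m) :
    jComp hm (γ • A) = jComp hm A := by
  funext z
  rw [jComp, jComp, fixedDetToGL_smul, jInv_smul]

lemma exists_precompSL_jComp (γ : SL(2, ℤ)) (A : FixedDetMatrix (Fin 2) ℤ m) :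
    ∃ B, precompSL γ (jComp hm A) = jComp hm B := by
  let B : FixedDetMatrix (Fin 2) ℤ m := ⟨A.1 * γ, by simp [A.2]⟩
  refine ⟨B, funext fun z ↦ ?_⟩
  have : fixedDetToGL hm B = fixedDetToGL hm A * Matrix.SpecialLinearGroup.mapGL ℝ γ := by
    apply Units.ext
    exact Matrix.map_mul
  rw [jComp, this, mul_smul]
  rfl

lemma exists_reps_jComp_eq (A : FixedDetMatrix (Fin 2) ℤ m) :
    ∃ B ∈ reps (m : ℤ), jComp hm A = jComp hm B := by
  refine induction_on (C := fun A ↦ ∃ B ∈ reps (m : ℤ), jComp hm A = jComp hm B)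
    (by exact_mod_cast hm) (fun A h1 h2 h3 h4 ↦ ⟨A, ⟨h1, h2, h3, h4⟩, rfl⟩) ?_ ?_
  all_goals
    rintro B ⟨B', hB', hBB'⟩
    exact ⟨B', hB', by rw [jComp_smul, hBB']⟩

lemma finite_range_jComp : (Set.range (jComp hm)).Finite := by
  refine (Set.toFinite (jComp hm '' reps (m : ℤ))).subset ?_
  rintro _ ⟨A, rfl⟩
  obtain ⟨B, hB, h⟩ := exists_reps_jComp_eq hm A
  exact ⟨B, hB, h.symm⟩

lemma isIntegral_of_pow_eq_one {x : ℂ} {n : ℕ} (hn : n ≠ 0) (hx : x ^ n = 1) : IsIntegral ℤ x :=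
  .of_pow (Nat.pos_of_ne_zero hn) (hx ▸ isIntegral_one)

lemma jInv_sub_jComp_mem (hsq : ¬ IsSquare m) {A : FixedDetMatrix (Fin 2) ℤ m}
    (hA : A ∈ reps (m : ℤ)) :
    (fun z : ℍ ↦ jInv z) - jComp hm A ∈ unitPuiseux (integralClosure ℤ ℂ).toSubring m := by
  obtain ⟨h10, h00, -, h11⟩ := hA
  have hdet : A.1 0 0 * A.1 1 1 = m := by
    simpa [Matrix.det_fin_two, h10] using A.2
  obtain ⟨a, ha⟩ : ∃ a : ℕ, A.1 0 0 = a := Int.eq_ofNat_of_zero_le h00.le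
  obtain ⟨d, hd⟩ : ∃ d : ℕ, A.1 1 1 = d := by
    refine Int.eq_ofNat_of_zero_le (le_of_lt (pos_of_mul_pos_right ?_ h00.le))
    rw [hdet]
    exact_mod_cast Nat.pos_of_ne_zero hm
  have had : a * d = m := by
    rw [ha, hd] at hdet
    exact_mod_cast hdet
  have ha0 : a ≠ 0 := by
    rintro rfl
    exact hm (by rw [← had, zero_mul])
  have hd0 : d ≠ 0 := by
    rintro rfl
    exact hm (by rw [← had, mul_zero])
  set b := A.1 0 1
  set R := (integralClosure ℤ ℂ).toSubring
  set c : ℂ := Complex.exp (2 * Real.pi * Complex.I * b / d)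
  have hc0 : c ≠ 0 := Complex.exp_ne_zero _
  have hcd : c ^ d = 1 := by
    rw [← Complex.exp_nat_mul, Complex.exp_eq_one_iff]
    exact ⟨b, by field_simp⟩
  have hcR : c ∈ R := isIntegral_of_pow_eq_one hd0 hcd
  have hcR' : c⁻¹ ∈ R := isIntegral_of_pow_eq_one hd0 (by rw [inv_pow, hcd, inv_one])
  have hcn : ‖c‖ = 1 := Complex.norm_eq_one_of_pow_eq_one hcd hd0
  have hj (z : ℍ) : jInv z * qParam m z ^ m = jSeries (1 * qParam m z ^ m) := by
    rw [qParam_natCast_pow hm, one_mul, jInv_mul_qParam]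
  have hq (z : ℍ) : qParam 1 ↑(fixedDetToGL hm A • z) = c * qParam m z ^ (a ^ 2) := by
    have hm' : (m : ℂ) = a * d := by exact_mod_cast had.symm
    have ha' : (a : ℂ) ≠ 0 := by exact_mod_cast ha0
    have hd' : (d : ℂ) ≠ 0 := by exact_mod_cast hd0
    rw [coe_fixedDetToGL_smul, h10, ha, hd, show A.1 0 1 = b from rfl, qParam, qParam,
      ← Complex.exp_nat_mul, ← Complex.exp_add]
    congr 1
    push_cast
    rw [hm', zero_mul, zero_add]
    field_simp
    ring
  have hjA (z : ℍ) : jComp hm A z * (c * qParam m z ^ (a ^ 2)) =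
      jSeries (c * qParam m z ^ (a ^ 2)) := by
    rw [← hq, jComp, jInv_mul_qParam]
  have hu : (fun q ↦ jSeries (1 * q ^ m)) ∈ discSeries R :=
    discSeries.comp_mul_pow_mem (jSeries_mem R) (one_mem R) (by simp) hm
  have ha2 : a ^ 2 ≠ 0 := pow_ne_zero 2 ha0
  have hv : (fun q ↦ c⁻¹) * (fun q ↦ jSeries (c * q ^ (a ^ 2))) ∈ discSeries R :=
    mul_mem (discSeries.const_mem hcR')
      (discSeries.comp_mul_pow_mem (jSeries_mem R) hcR hcn ha2)
  have hne : a ^ 2 ≠ m := fun h ↦ hsq ⟨a, by rw [← h, sq]⟩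
  rcases hne.lt_or_gt with hlt | hgt
  · obtain ⟨k, hk⟩ := Nat.exists_eq_add_of_lt hlt
    refine ⟨m, _, sub_mem hu (mul_mem (discSeries.pow_mem (k + 1)) hv), ?_, ?_, fun z ↦ ?_⟩
    · simp [jSeries_zero, hm]
    · simp [jSeries_zero, hm]
    · simp only [Pi.sub_apply, Pi.mul_apply, ← hj, ← hjA, sub_mul]
      have : qParam m z ^ m = qParam m z ^ (k + 1) * qParam m z ^ (a ^ 2) := by
        rw [← pow_add]
        congr 1
        omega
      rw [this]
      field_simp
  · obtain ⟨k, hk⟩ := Nat.exists_eq_add_of_lt hgt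
    refine ⟨a ^ 2, _, sub_mem (mul_mem (discSeries.pow_mem (k + 1)) hu) hv, ?_, ?_, fun z ↦ ?_⟩
    · simp [jSeries_zero, ha0, hc0]
    · simpa [jSeries_zero, ha0] using neg_mem hcR
    · simp only [Pi.sub_apply, Pi.mul_apply, ← hj, ← hjA, sub_mul]
      have : qParam m z ^ (a ^ 2) = qParam m z ^ (k + 1) * qParam m z ^ m := by
        rw [← pow_add]
        congr 1
        omega
      rw [this]
      field_simp

lemma isIntegral_of_subring {R : Subring ℂ} (hR : ∀ r ∈ R, IsIntegral ℤ r) {x : ℂ}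
    (hx : IsIntegral R x) : IsIntegral ℤ x := by
  have : Algebra.IsIntegral ℤ R := ⟨fun r ↦ by
    have : Function.Injective (algebraMap R ℂ) := Subtype.val_injective
    exact (isIntegral_algebraMap_iff this).mp (hR r r.2)⟩
  exact isIntegral_trans x hx

/-- If `τ` is fixed by an integral matrix with nonsquare determinant `m > 0`, then `j(τ)` is an
algebraic integer. -/
lemma isIntegral_jInv_of_fixed (hsq : ¬ IsSquare m) (A : FixedDetMatrix (Fin 2) ℤ m) {τ : ℍ}
    (hτ : fixedDetToGL hm A • τ = τ) : IsIntegral ℤ (jInv τ) := by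
  set R := (integralClosure ℤ ℂ).toSubring
  set s := (finite_range_jComp hm).toFinset
  have hs (F) (hF : F ∈ s) (γ) : precompSL γ F ∈ s := by
    simp only [s, Set.Finite.mem_toFinset, Set.mem_range] at hF ⊢
    obtain ⟨B, rfl⟩ := hF
    obtain ⟨B', hB'⟩ := exists_precompSL_jComp hm γ B
    exact ⟨B', hB'.symm⟩
  set j : ℍ → ℂ := fun z ↦ jInv z
  have hj (γ) : precompSL γ j = j := funext fun z ↦ jInv_smul γ z
  set H : ℍ → ℂ := ∏ F ∈ s, (j - F)
  have hinv (γ : SL(2, ℤ)) (z : ℍ) : H (γ • z) = H z := by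
    have : precompSL γ H = H := by
      rw [map_prod]
      simp only [map_sub, hj]
      exact prod_precompSL hs γ fun F ↦ j - F
    exact congr_fun this z
  have hH : H ∈ unitPuiseux R m := by
    refine prod_mem fun F hF ↦ ?_
    obtain ⟨B, rfl⟩ := (finite_range_jComp hm).mem_toFinset.mp hF
    obtain ⟨B', hB', h⟩ := exists_reps_jComp_eq hm B
    rw [h]
    exact jInv_sub_jComp_mem hm hsq hB'
  obtain ⟨n, g, hg, hg0, hgR, hHg⟩ := hH
  obtain ⟨P, -, hlead, hP⟩ := exists_eq_aeval_jInv hm n H g hinv hg hHg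
  have hHτ : H τ = 0 := by
    change (∏ F ∈ s, (j - F)) τ = 0
    rw [Finset.prod_apply]
    refine Finset.prod_eq_zero (i := jComp hm A) (by simp [s]) ?_
    simp [j, jComp, hτ]
  refine isIntegral_of_subring (R := R) (fun r hr ↦ hr) ⟨C ⟨(g 0)⁻¹, hgR⟩ * P, ?_, ?_⟩
  · refine monic_C_mul_of_mul_leadingCoeff_eq_one (Subtype.ext ?_)
    rw [Subring.coe_mul, hlead hg0]
    exact inv_mul_cancel₀ hg0
  · rw [← aeval_def, map_mul, ← hP, hHτ, mul_zero]

lemma exists_nonsquare_det (a b c : ℤ) (h : b ^ 2 - 4 * a * c < 0) :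
    ∃ x : ℤ, ∃ m : ℕ, m ≠ 0 ∧ ¬ IsSquare m ∧ (x - b) * x - -c * a = m := by
  set n := 4 * a * c - b ^ 2 with hn
  have hn0 : 0 < n := by omega
  set x := n + |b| with hx
  have hb : b ≤ |b| := le_abs_self b
  have hpos : 0 < (x - b) * x - -c * a := by nlinarith [sq_nonneg (2 * x - b)]
  refine ⟨x, ((x - b) * x - -c * a).toNat, by omega, ?_, (Int.toNat_of_nonneg hpos.le).symm⟩
  rintro ⟨y, hy⟩
  have hy' : (x - b) * x - -c * a = (y : ℤ) * y := by
    rw [← Int.toNat_of_nonneg hpos.le, hy, Nat.cast_mul]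
  have hkey : (2 * (y : ℤ)) ^ 2 = (2 * x - b) ^ 2 + n := by linear_combination -4 * hy' + hn
  have h1 : n < 2 * x - b := by linarith [abs_nonneg b]
  have h2 : 2 * x - b < 2 * (y : ℤ) := by
    by_contra! hle
    nlinarith
  nlinarith

/-- Singular moduli are algebraic integers. -/
theorem isIntegral_jInv (τ : ℍ) {a b c : ℤ} (hdisc : b ^ 2 - 4 * a * c < 0)
    (hτ : (a : ℂ) * τ ^ 2 + b * τ + c = 0) : IsIntegral ℤ (jInv τ) := by
  obtain ⟨x, m, hm, hsq, hdet⟩ := exists_nonsquare_det a b c hdisc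
  let A : FixedDetMatrix (Fin 2) ℤ m := ⟨!![x - b, -c; a, x], by rw [Matrix.det_fin_two_of, hdet]⟩
  refine isIntegral_jInv_of_fixed hm hsq A (UpperHalfPlane.ext ?_)
  rw [coe_fixedDetToGL_smul]
  have hden : (a : ℂ) * τ + x ≠ 0 := by
    intro h0
    have hre : ((a : ℂ) * τ + x).im = 0 := by rw [h0, Complex.zero_im]
    have ha : a ≠ 0 := by
      rintro rfl
      nlinarith [sq_nonneg b]
    simp [ha, τ.im_ne_zero] at hre
  change ((x - b : ℤ) * (τ : ℂ) + (-c : ℤ)) / (a * τ + x) = τ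
  rw [div_eq_iff hden]
  push_cast
  linear_combination -hτ

end Singular

section ModularFunction

open UpperHalfPlane MatrixGroups Function.Periodic Polynomial

lemma moebiusZ_coe (γ : SL(2, ℤ)) (z : ℍ) : moebiusZ γ z = ↑(γ • z) := by
  rw [UpperHalfPlane.coe_specialLinearGroup_apply]
  simp [moebiusZ]

lemma mem_puiseux_of_hasSum {R : Subring ℂ} {N n₀ : ℕ} (hN : N ≠ 0) {F : ℍ → ℂ} {a : ℕ → ℂ}
    (haR : ∀ n, a n ∈ R)
    (hF : ∀ z : ℍ, HasSum
      (fun n : ℕ ↦ a n * Complex.exp (2 * Real.pi * Complex.I * ((n : ℂ) - n₀) * z / N)) (F z)) :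
    F ∈ puiseux R N := by
  have hN' : (0 : ℝ) < N := by positivity
  have hsum (z : ℍ) : HasSum (fun n ↦ a n * qParam N z ^ n) (F z * qParam N z ^ n₀) := by
    refine ((hF z).mul_right (qParam N z ^ n₀)).congr_fun fun n ↦ ?_
    rw [mul_assoc, qParam, ← Complex.exp_nat_mul, ← Complex.exp_nat_mul, ← Complex.exp_add]
    congr 2
    push_cast
    ring
  refine ⟨n₀, fun q ↦ ∑' n, a n * q ^ n, ⟨a, haR, fun q hq ↦ Summable.hasSum ?_⟩,
    fun z ↦ (hsum z).tsum_eq.symm⟩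
  rcases eq_or_ne q 0 with rfl | hq0
  · exact summable_of_ne_finset_zero (s := {0}) fun n hn ↦ by simp_all
  · have him := im_invQParam_pos_of_norm_lt_one hN' hq hq0
    have := (hsum ⟨_, him⟩).summable
    simpa only [UpperHalfPlane.coe_mk, qParam_right_inv hN'.ne' hq0] using this

/-- Over a finite family of functions permuted by `SL(2, ℤ)`, the polynomial whose roots are the
values at `τ` has coefficients in `R[j(τ)]`. -/
lemma exists_coeff_prod_X_sub_C_eq_aeval_jInv {R : Subring ℂ} {N : ℕ} (hN : N ≠ 0)
    {s : Finset (ℍ → ℂ)} (hs : ∀ F ∈ s, ∀ γ, precompSL γ F ∈ s)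
    (hR : ∀ F ∈ s, F ∈ puiseux R N) (τ : ℍ) (i : ℕ) :
    ∃ P : R[X], (∏ F ∈ s, (X - C (F τ))).coeff i = aeval (jInv τ) P := by
  set Q : (ℍ → ℂ)[X] := ∏ F ∈ s, (X - C F)
  have hinv (γ : SL(2, ℤ)) : precompSL γ (Q.coeff i) = Q.coeff i := by
    rw [← coeff_map, Polynomial.map_prod]
    simp only [Polynomial.map_sub, map_X, map_C]
    rw [prod_precompSL hs γ fun F ↦ X - C F]
  have hmem : Q.coeff i ∈ puiseux R N := by
    have hQ : Q ∈ lifts (puiseux R N).subtype :=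
      prod_mem fun F hF ↦ ⟨X - C (⟨F, hR F hF⟩ : puiseux R N), by simp⟩
    obtain ⟨F, hF⟩ := (lifts_iff_coeff_lifts Q).mp hQ i
    rw [← hF]
    exact F.2
  obtain ⟨n, g, hg, hQg⟩ := hmem
  obtain ⟨P, -, -, hP⟩ := exists_eq_aeval_jInv hN n _ g (fun γ ↦ congr_fun (hinv γ)) hg hQg
  refine ⟨P, ?_⟩
  have hQτ : Q.map (Pi.evalRingHom (fun _ ↦ ℂ) τ) = ∏ F ∈ s, (X - C (F τ)) := by
    simp [Q, Polynomial.map_prod]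
  rw [← hP, ← hQτ, coeff_map]
  rfl

lemma exists_finset_orbit {Γ : Subgroup SL(2, ℤ)} (hind : Γ.index ≠ 0) {F : ℍ → ℂ}
    (hinv : ∀ γ ∈ Γ, precompSL γ F = F) :
    ∃ s : Finset (ℍ → ℂ), s.card ≤ Γ.index ∧ ∀ G, G ∈ s ↔ ∃ γ, precompSL γ F = G := by
  have : Γ.FiniteIndex := ⟨hind⟩
  let φ : SL(2, ℤ) ⧸ Γ → ℍ → ℂ := Quotient.lift (fun γ ↦ precompSL γ⁻¹ F) fun γ δ h ↦ by
    have h' := hinv _ (QuotientGroup.leftRel_apply.mp h)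
    funext z
    have := congr_fun h' (δ⁻¹ • z)
    simpa [mul_smul] using this
  have : Fintype (SL(2, ℤ) ⧸ Γ) := Fintype.ofFinite _
  classical
  refine ⟨Finset.univ.image φ, ?_, fun G ↦ ⟨fun hG ↦ ?_, ?_⟩⟩
  · rw [Subgroup.index, Nat.card_eq_fintype_card]
    exact Finset.card_image_le
  · obtain ⟨x, -, rfl⟩ := Finset.mem_image.mp hG
    obtain ⟨γ, rfl⟩ := QuotientGroup.mk_surjective x
    exact ⟨γ⁻¹, rfl⟩
  · rintro ⟨γ, rfl⟩
    refine Finset.mem_image.mpr ⟨QuotientGroup.mk γ⁻¹, Finset.mem_univ _, ?_⟩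
    change precompSL γ⁻¹⁻¹ F = _
    rw [inv_inv]

lemma isIntegral_of_root_of_coeff {p : ℂ[X]} (hp : p.Monic) (hcoeff : ∀ i, IsIntegral ℤ (p.coeff i))
    {x : ℂ} (hx : p.eval x = 0) : IsIntegral ℤ x := by
  set R := (integralClosure ℤ ℂ).toSubring
  have hsub : (p.coeffs : Set ℂ) ⊆ R := fun c hc ↦ by
    obtain ⟨i, -, rfl⟩ := mem_coeffs_iff.mp hc
    exact hcoeff i
  refine isIntegral_of_subring (R := R) (fun r hr ↦ hr)
    ⟨p.toSubring R hsub, (monic_toSubring p R hsub).mpr hp, ?_⟩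
  rw [← eval_map]
  change (map R.subtype (p.toSubring R hsub)).eval x = 0
  rw [map_toSubring, hx]

end ModularFunction

/-- A weakly holomorphic modular function for a level `N` congruence subgroup whose Fourier
expansions at all cusps have coefficients in `ℤ[ζ_N]` takes algebraic-integer values at CM
points, of degree at most `[SL₂(ℤ):Γ]` over `ℚ(ζ_N, j(τ₀))`. -/
theorem cm_value_is_algebraic_integer
    (N : ℕ) (hN : 0 < N) (Γ : Subgroup (Matrix.SpecialLinearGroup (Fin 2) ℤ))
    (hΓ : CongruenceSubgroup.Gamma N ≤ Γ) (hind : Γ.index ≠ 0)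
    (f : ℂ → ℂ) (hol : DifferentiableOn ℂ f {z : ℂ | 0 < z.im})
    (hinv : ∀ γ ∈ Γ, ∀ z : ℂ, 0 < z.im → f (moebiusZ γ z) = f z)
    (ζ : ℂ) (hζ : ζ = Complex.exp (2 * Real.pi * Complex.I / N))
    (hfourier : ∀ γ : Matrix.SpecialLinearGroup (Fin 2) ℤ, ∃ n₀ : ℕ, ∃ a : ℕ → ℂ,
      (∀ n, a n ∈ Subring.closure ({ζ} : Set ℂ)) ∧
      ∀ z : ℂ, 0 < z.im → HasSum
        (fun n : ℕ => a n * Complex.exp (2 * Real.pi * Complex.I * ((n : ℂ) - n₀) * z / N))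
        (f (moebiusZ γ z)))
    (τ₀ : ℂ) (hτ₀ : 0 < τ₀.im)
    (hCM : ∃ a b c : ℤ, a ≠ 0 ∧ b ^ 2 - 4 * a * c < 0 ∧
      (a : ℂ) * τ₀ ^ 2 + (b : ℂ) * τ₀ + (c : ℂ) = 0) :
    IsIntegral ℤ (f τ₀) ∧
    ∃ p : Polynomial ℂ, p.Monic ∧ p.natDegree ≤ Γ.index ∧
      (∀ i, p.coeff i ∈ Subfield.closure ({ζ, jInv τ₀} : Set ℂ)) ∧
      p.eval (f τ₀) = 0 := by
  set R := Subring.closure ({ζ} : Set ℂ)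
  lift τ₀ to UpperHalfPlane using hτ₀
  obtain ⟨a, b, c, -, hdisc, hτ⟩ := hCM
  have hj := isIntegral_jInv τ₀ hdisc hτ
  have hR (r) (hr : r ∈ R) : IsIntegral ℤ r := by
    have hζN : ζ ^ N = 1 := by
      rw [hζ]
      exact (Complex.isPrimitiveRoot_exp N hN.ne').pow_eq_one
    have hle : R ≤ (integralClosure ℤ ℂ).toSubring :=
      Subring.closure_le.mpr (Set.singleton_subset_iff.mpr (isIntegral_of_pow_eq_one hN.ne' hζN))
    exact hle hr
  set F : UpperHalfPlane → ℂ := fun z ↦ f z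
  have hF (γ) (z : UpperHalfPlane) : precompSL γ F z = f (moebiusZ γ z) := by
    rw [moebiusZ_coe, precompSL_apply]
  obtain ⟨s, hcard, hs⟩ := exists_finset_orbit hind (F := F) fun γ hγ ↦
    funext fun z ↦ (hF γ z).trans (hinv γ hγ z z.im_pos)
  have hsmul (G) (hG : G ∈ s) (γ) : precompSL γ G ∈ s := by
    obtain ⟨δ, rfl⟩ := (hs G).mp hG
    exact (hs _).mpr ⟨δ * γ, funext fun z ↦ by simp [mul_smul]⟩
  have hpui (G) (hG : G ∈ s) : G ∈ puiseux R N := by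
    obtain ⟨γ, rfl⟩ := (hs G).mp hG
    obtain ⟨n₀, a, haR, ha⟩ := hfourier γ
    exact mem_puiseux_of_hasSum hN.ne' haR fun z ↦ hF γ z ▸ ha z z.im_pos
  have hcoeff := exists_coeff_prod_X_sub_C_eq_aeval_jInv hN.ne' hsmul hpui τ₀
  set p : Polynomial ℂ := ∏ G ∈ s, (Polynomial.X - Polynomial.C (G τ₀))
  have hmonic : p.Monic := Polynomial.monic_prod_X_sub_C _ _
  have hroot : p.eval (f τ₀) = 0 := by
    rw [Polynomial.eval_prod]
    exact Finset.prod_eq_zero (i := F) ((hs F).mpr ⟨1, by funext z; simp⟩) (by simp [F])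
  refine ⟨isIntegral_of_root_of_coeff hmonic (fun i ↦ ?_) hroot, p, hmonic, ?_, fun i ↦ ?_, hroot⟩
  · obtain ⟨P, hP⟩ := hcoeff i
    rw [hP, Polynomial.aeval_eq_sum_range]
    exact IsIntegral.sum _ fun k _ ↦ (hR _ (P.coeff k).2).mul (hj.pow k)
  · rwa [Polynomial.natDegree_finsetProd_X_sub_C_eq_card]
  · obtain ⟨P, hP⟩ := hcoeff i
    rw [hP, Polynomial.aeval_eq_sum_range]
    have hle : R ≤ (Subfield.closure ({ζ, jInv τ₀} : Set ℂ)).toSubring :=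
      Subring.closure_le.mpr (Set.singleton_subset_iff.mpr (Subfield.subset_closure (by simp)))
    exact sum_mem fun k _ ↦ mul_mem (hle (P.coeff k).2)
      (pow_mem (Subfield.subset_closure (by simp)) k)

end
end

section
/- The cusp form g(z) = η(z)²η(2z)²η(3z)²η(6z)² of weight 4 for Γ₀(6) satisfies g|₄ W_Q = g for every Atkin-Lehner involution W_Q with Q ∈ {1, 2, 3, 6}, where W_Q is any integral matrix (Qα, β; 6γ, Qδ) of determinant Q. -/
noncomputable section

open Complex

/-- The Dedekind eta function `η(z) = q^{1/24} ∏_{n≥1}(1 - qⁿ)`. -/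
def dedekindEta (z : ℂ) : ℂ :=
  Complex.exp (Real.pi * Complex.I * z / 12) * ∏' n : ℕ, (1 - nome z ^ (n + 1))

/-- The weight `k` slash operator for an integral matrix of positive determinant. -/
def slash (k : ℤ) (M : Matrix (Fin 2) (Fin 2) ℤ) (f : ℂ → ℂ) : ℂ → ℂ := fun z =>
  ((M.det : ℂ) ^ ((k : ℂ) / 2)) * ((M 1 0 : ℂ) * z + (M 1 1 : ℂ)) ^ (-k)
    * f (((M 0 0 : ℂ) * z + (M 0 1 : ℂ)) / ((M 1 0 : ℂ) * z + (M 1 1 : ℂ)))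

/-- The cusp form `g(z) = η(z)²η(2z)²η(3z)²η(6z)²` of weight 4 for `Γ₀(6)`. -/
def etaProd (z : ℂ) : ℂ :=
  dedekindEta z ^ 2 * dedekindEta (2 * z) ^ 2 * dedekindEta (3 * z) ^ 2 * dedekindEta (6 * z) ^ 2

/-- An explicit lift to `ℤ` of the abelianization map `SL(2, ℤ) → ℤ/12`. -/
def etaSqExponent {R : Type*} [Ring R] (a b c d : R) : R :=
  (1 - c ^ 2) * (b * d + 3 * (c - 1) * d + c + 3) + c * (a + d - 3)

/-- The value at `T` of the multiplier of `η²`, a primitive twelfth root of unity. -/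
def etaSqRoot : ℂ := Complex.exp (Real.pi * Complex.I / 6)

lemma etaSqRoot_ne_zero : etaSqRoot ≠ 0 := Complex.exp_ne_zero _

lemma etaSqRoot_pow_twelve : etaSqRoot ^ 12 = 1 := by
  rw [etaSqRoot, ← Complex.exp_nat_mul, ← Complex.exp_two_pi_mul_I]
  congr 1
  push_cast
  ring

lemma etaSqRoot_pow_three : etaSqRoot ^ 3 = Complex.I := by
  rw [etaSqRoot, ← Complex.exp_nat_mul, show ((3 : ℕ) : ℂ) * (Real.pi * I / 6) = Real.pi / 2 * I by
      push_cast
      ring,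
    Complex.exp_pi_div_two_mul_I]

lemma etaSqRoot_zpow_eq {m n : ℤ} (h : (12 : ℤ) ∣ m - n) : etaSqRoot ^ m = etaSqRoot ^ n := by
  obtain ⟨k, hk⟩ := h
  rw [show m = n + 12 * k by lia, zpow_add₀ etaSqRoot_ne_zero, zpow_mul]
  have : etaSqRoot ^ (12 : ℤ) = 1 := mod_cast etaSqRoot_pow_twelve
  simp [this]

lemma twelve_dvd_of_zmod {n : ℤ} (h3 : (n : ZMod 3) = 0) (h4 : (n : ZMod 4) = 0) :
    (12 : ℤ) ∣ n := by
  rw [ZMod.intCast_zmod_eq_zero_iff_dvd] at h3 h4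
  lia

lemma intCast_etaSqExponent {R : Type*} [Ring R] (a b c d : ℤ) :
    ((etaSqExponent a b c d : ℤ) : R) = etaSqExponent (a : R) b c d := by
  simp [etaSqExponent]

lemma etaSqExponent_mul_T {a b c d : ℤ} (h : a * d - b * c = 1) :
    (12 : ℤ) ∣ etaSqExponent a (a + b) c (c + d) - (etaSqExponent a b c d + 1) := by
  have h3 := congrArg (Int.cast : ℤ → ZMod 3) h
  have h4 := congrArg (Int.cast : ℤ → ZMod 4) h
  apply twelve_dvd_of_zmod
  · push_cast [intCast_etaSqExponent] at h3 ⊢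
    generalize (a : ZMod 3) = a, (b : ZMod 3) = b, (c : ZMod 3) = c, (d : ZMod 3) = d at *
    revert a b c d
    unfold etaSqExponent
    decide +kernel
  · push_cast [intCast_etaSqExponent] at h4 ⊢
    generalize (a : ZMod 4) = a, (b : ZMod 4) = b, (c : ZMod 4) = c, (d : ZMod 4) = d at *
    revert a b c d
    unfold etaSqExponent
    decide +kernel

lemma etaSqExponent_mul_S {a b c d : ℤ} (h : a * d - b * c = 1) :
    (12 : ℤ) ∣ etaSqExponent b (-a) d (-c) - (etaSqExponent a b c d - 3) := by
  have h3 := congrArg (Int.cast : ℤ → ZMod 3) h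
  have h4 := congrArg (Int.cast : ℤ → ZMod 4) h
  apply twelve_dvd_of_zmod
  · push_cast [intCast_etaSqExponent] at h3 ⊢
    generalize (a : ZMod 3) = a, (b : ZMod 3) = b, (c : ZMod 3) = c, (d : ZMod 3) = d at *
    revert a b c d
    unfold etaSqExponent
    decide +kernel
  · push_cast [intCast_etaSqExponent] at h4 ⊢
    generalize (a : ZMod 4) = a, (b : ZMod 4) = b, (c : ZMod 4) = c, (d : ZMod 4) = d at *
    revert a b c d
    unfold etaSqExponent
    decide +kernel

/-- Writing `2 = s * s'`, `3 = t * t'` and `Q = s * t`, these are the exponents of the four matrices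
that an Atkin-Lehner matrix of determinant `Q` induces on the factors `η(mz)²`, `m ∣ 6`. -/
lemma etaSqExponent_atkin_lehner {s s' t t' α β γ δ : ℤ} (hs : s = 1 ∧ s' = 2 ∨ s = 2 ∧ s' = 1)
    (ht : t = 1 ∧ t' = 3 ∨ t = 3 ∧ t' = 1) (h : s * t * α * δ - s' * t' * β * γ = 1) :
    (12 : ℤ) ∣ etaSqExponent α β (s' * t' * γ) (s * t * δ) +
      etaSqExponent (s * α) (s' * β) (t' * γ) (t * δ) +
      etaSqExponent (t * α) (t' * β) (s' * γ) (s * δ) +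
      etaSqExponent (s * t * α) (s' * t' * β) γ δ := by
  have h3 := congrArg (Int.cast : ℤ → ZMod 3) h
  have h4 := congrArg (Int.cast : ℤ → ZMod 4) h
  apply twelve_dvd_of_zmod
  · rcases hs with ⟨rfl, rfl⟩ | ⟨rfl, rfl⟩ <;> rcases ht with ⟨rfl, rfl⟩ | ⟨rfl, rfl⟩ <;>
    · push_cast [intCast_etaSqExponent] at h3 ⊢
      generalize (α : ZMod 3) = a, (β : ZMod 3) = b, (γ : ZMod 3) = c, (δ : ZMod 3) = d at *
      clear h h4
      revert a b c d
      unfold etaSqExponent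
      decide +kernel
  · rcases hs with ⟨rfl, rfl⟩ | ⟨rfl, rfl⟩ <;> rcases ht with ⟨rfl, rfl⟩ | ⟨rfl, rfl⟩ <;>
    · push_cast [intCast_etaSqExponent] at h4 ⊢
      generalize (α : ZMod 4) = a, (β : ZMod 4) = b, (γ : ZMod 4) = c, (δ : ZMod 4) = d at *
      clear h h3
      revert a b c d
      unfold etaSqExponent
      decide +kernel

lemma dedekindEta_eq_eta (z : ℂ) : dedekindEta z = ModularForm.eta z := by
  simp only [dedekindEta, ModularForm.eta, ModularForm.eta_q, nome, Function.Periodic.qParam]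
  congr 2
  · push_cast
    ring
  · simp

lemma dedekindEta_sq_add_one (z : ℂ) :
    dedekindEta (z + 1) ^ 2 = etaSqRoot * dedekindEta z ^ 2 := by
  have hn : nome (z + 1) = nome z := by
    rw [nome, nome, mul_add, mul_one, Complex.exp_add, Complex.exp_two_pi_mul_I, mul_one]
  rw [dedekindEta, dedekindEta, hn, mul_pow, mul_pow, ← mul_assoc, ← Complex.exp_nat_mul,
    ← Complex.exp_nat_mul, etaSqRoot, ← Complex.exp_add]
  congr 2
  push_cast
  ring

lemma dedekindEta_sq_neg_inv {z : ℂ} (hz : 0 < z.im) :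
    dedekindEta (-1 / z) ^ 2 = etaSqRoot ^ (-3 : ℤ) * z * dedekindEta z ^ 2 := by
  have h := ModularForm.eta_comp_eq_csqrt_I_inv hz
  have hs (w : ℂ) : sqrt w ^ 2 = w := by simp [Complex.sqrt, ← Complex.cpow_nat_mul]
  have h3 : etaSqRoot ^ (-3 : ℤ) = Complex.I⁻¹ := by
    rw [zpow_neg, ← etaSqRoot_pow_three]
    norm_cast
  simp only [Function.comp_apply, Pi.smul_apply, Pi.mul_apply, smul_eq_mul] at h
  rw [dedekindEta_eq_eta, dedekindEta_eq_eta, h, h3, mul_pow, mul_pow, inv_pow, hs, hs, mul_assoc]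

/-- The weight one transformation law of `η²` at `z` under the matrix `(a, b; c, d)`. -/
def EtaSqLaw (a b c d : ℤ) (z : ℂ) : Prop :=
  dedekindEta ((a * z + b) / (c * z + d)) ^ 2 =
    etaSqRoot ^ etaSqExponent a b c d * (c * z + d) * dedekindEta z ^ 2

lemma etaSqLaw_mul_T_iff {a b c d : ℤ} (h : a * d - b * c = 1) (z : ℂ) :
    EtaSqLaw a (a + b) c (c + d) z ↔ EtaSqLaw a b c d (z + 1) := by
  rw [EtaSqLaw, EtaSqLaw, etaSqRoot_zpow_eq (etaSqExponent_mul_T h), dedekindEta_sq_add_one,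
    zpow_add_one₀ etaSqRoot_ne_zero]
  push_cast
  ring_nf

lemma etaSqLaw_mul_S_iff {a b c d : ℤ} (h : a * d - b * c = 1) {z : ℂ} (hz : 0 < z.im) :
    EtaSqLaw b (-a) d (-c) z ↔ EtaSqLaw a b c d (-1 / z) := by
  have hz0 : z ≠ 0 := by
    rintro rfl
    simp at hz
  have harg : ((b : ℂ) * z + (-a : ℤ)) / (d * z + (-c : ℤ)) =
      (a * (-1 / z) + b) / (c * (-1 / z) + d) := by
    rw [← mul_div_mul_right (_ * (-1 / z) + _) _ hz0]
    push_cast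
    congr 1 <;> field_simp <;> ring
  rw [EtaSqLaw, EtaSqLaw, etaSqRoot_zpow_eq (etaSqExponent_mul_S h), dedekindEta_sq_neg_inv hz,
    harg, sub_eq_add_neg, zpow_add₀ etaSqRoot_ne_zero]
  have hfac : (d : ℂ) * z + (-c : ℤ) = (c * (-1 / z) + d) * z := by
    push_cast
    field_simp
    ring
  rw [hfac]
  ring_nf

lemma im_neg_one_div_pos {z : ℂ} (hz : 0 < z.im) : 0 < (-1 / z).im := by
  have hz0 : z ≠ 0 := by
    rintro rfl
    simp at hz
  rw [neg_div, one_div, Complex.neg_im, Complex.inv_im, neg_div, neg_neg]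
  exact div_pos hz (Complex.normSq_pos.mpr hz0)

lemma forall_etaSqLaw_mul_T_iff {a b c d : ℤ} (h : a * d - b * c = 1) :
    (∀ z : ℂ, 0 < z.im → EtaSqLaw a (a + b) c (c + d) z) ↔
      ∀ z : ℂ, 0 < z.im → EtaSqLaw a b c d z := by
  refine ⟨fun H z hz ↦ ?_, fun H z hz ↦ (etaSqLaw_mul_T_iff h z).mpr (H _ (by simpa using hz))⟩
  simpa using (etaSqLaw_mul_T_iff h (z - 1)).mp (H _ (by simpa using hz))

lemma forall_etaSqLaw_mul_S_iff {a b c d : ℤ} (h : a * d - b * c = 1) :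
    (∀ z : ℂ, 0 < z.im → EtaSqLaw b (-a) d (-c) z) ↔
      ∀ z : ℂ, 0 < z.im → EtaSqLaw a b c d z := by
  refine ⟨fun H z hz ↦ ?_,
    fun H z hz ↦ (etaSqLaw_mul_S_iff h hz).mpr (H _ (im_neg_one_div_pos hz))⟩
  have hz' := im_neg_one_div_pos hz
  convert (etaSqLaw_mul_S_iff h hz').mp (H _ hz') using 1
  simp

lemma etaSqLaw_of_det_eq_one {a b c d : ℤ} (h : a * d - b * c = 1) {z : ℂ} (hz : 0 < z.im) :
    EtaSqLaw a b c d z := by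
  let p (M : Matrix.SpecialLinearGroup (Fin 2) ℤ) : Prop :=
    ∀ z : ℂ, 0 < z.im → EtaSqLaw (M 0 0) (M 0 1) (M 1 0) (M 1 1) z
  have hdet (M : Matrix.SpecialLinearGroup (Fin 2) ℤ) : M 0 0 * M 1 1 - M 0 1 * M 1 0 = 1 := by
    rw [← Matrix.det_fin_two, M.det_coe]
  have hgen (M A : Matrix.SpecialLinearGroup (Fin 2) ℤ)
      (hA : A ∈ ({ModularGroup.S, ModularGroup.T} : Set _)) : p (M * A) ↔ p M := by
    rcases hA with rfl | rfl
    · simpa [p, ModularGroup.coe_S, Matrix.mul_apply, Fin.sum_univ_two] using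
        forall_etaSqLaw_mul_S_iff (hdet M)
    · simpa [p, ModularGroup.coe_T, Matrix.mul_apply, Fin.sum_univ_two] using
        forall_etaSqLaw_mul_T_iff (hdet M)
  suffices hp : ∀ M, p M by
    simpa [p] using hp ⟨!![a, b; c, d], by rwa [Matrix.det_fin_two_of]⟩ z hz
  intro M
  have hM : M ∈ Subgroup.closure {ModularGroup.S, ModularGroup.T} := by
    simp [SpecialLinearGroup.SL2Z_generators]
  induction hM using Subgroup.closure_induction_right with
  | one => simp [p, EtaSqLaw, etaSqExponent]
  | mul_right M _ A hA ih => exact (hgen M A hA).mpr ih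
  | mul_inv_cancel M _ A hA ih => exact (hgen _ A hA).mp (by simpa using ih)

/-- The transformation of the factor `η(mz)²`, `m = g * μ`, under an Atkin-Lehner matrix of
determinant `g * q` and level `g * q * μ * ν`. -/
lemma dedekindEta_sq_atkin_lehner {g q μ ν α β γ δ : ℤ} (hg : g ≠ 0) (hqμ : 0 < q * μ)
    (h : g * q * α * δ - μ * ν * β * γ = 1) {z : ℂ} (hz : 0 < z.im) {m m' N D : ℂ}
    (hm : m = g * μ) (hm' : m' = q * μ) (hN : N = g * q * α * z + β)
    (hD : D = g * q * μ * ν * γ * z + g * q * δ) :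
    dedekindEta (m * (N / D)) ^ 2 =
      etaSqRoot ^ etaSqExponent (g * α) (μ * β) (ν * γ) (q * δ) *
        (D / g) * dedekindEta (m' * z) ^ 2 := by
  have hz' : 0 < (m' * z).im := by
    rw [hm', ← Int.cast_mul, ← Complex.ofReal_intCast, Complex.im_ofReal_mul]
    exact mul_pos (mod_cast hqμ) hz
  have hdet : g * α * (q * δ) - μ * β * (ν * γ) = 1 := by linear_combination h
  have hg' : (g : ℂ) ≠ 0 := mod_cast hg
  have hden : ((ν * γ : ℤ) : ℂ) * (m' * z) + (q * δ : ℤ) = D / g := by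
    rw [eq_div_iff hg', hm', hD]
    push_cast
    ring
  have hnum : ((g * α : ℤ) : ℂ) * (m' * z) + (μ * β : ℤ) = m * N / g := by
    rw [eq_div_iff hg', hm, hm', hN]
    push_cast
    ring
  have key := etaSqLaw_of_det_eq_one hdet hz'
  rwa [EtaSqLaw, hden, hnum, div_div_div_cancel_right₀ hg', mul_div_assoc] at key

lemma intCast_mul_add_ne_zero {a b c d : ℤ} (h : a * d - b * c ≠ 0) {z : ℂ} (hz : 0 < z.im) :
    (c : ℂ) * z + d ≠ 0 := by
  intro h0
  have him := congrArg Complex.im h0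
  have hc : c = 0 := by simpa [hz.ne'] using him
  subst hc
  have hd : d = 0 := by simpa using h0
  simp [hd] at h

lemma etaProd_div_eq {s s' t t' α β γ δ : ℤ} (hs : s = 1 ∧ s' = 2 ∨ s = 2 ∧ s' = 1)
    (ht : t = 1 ∧ t' = 3 ∨ t = 3 ∧ t' = 1) (h : s * t * α * δ - s' * t' * β * γ = 1) {z : ℂ}
    (hz : 0 < z.im) {N D : ℂ} (hN : N = s * t * α * z + β) (hD : D = 6 * γ * z + s * t * δ) :
    etaProd (N / D) = D ^ 4 / (s * t) ^ 2 * etaProd z := by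
  have hs0 : (s : ℂ) ≠ 0 := by
    rcases hs with ⟨rfl, rfl⟩ | ⟨rfl, rfl⟩ <;> norm_num
  have ht0 : (t : ℂ) ≠ 0 := by
    rcases ht with ⟨rfl, rfl⟩ | ⟨rfl, rfl⟩ <;> norm_num
  have hss : (s : ℂ) * s' = 2 := by
    rcases hs with ⟨rfl, rfl⟩ | ⟨rfl, rfl⟩ <;> norm_num
  have htt : (t : ℂ) * t' = 3 := by
    rcases ht with ⟨rfl, rfl⟩ | ⟨rfl, rfl⟩ <;> norm_num
  have hprod : s * t > 0 ∧ s' * t > 0 ∧ s * t' > 0 ∧ s' * t' > 0 := by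
    rcases hs with ⟨rfl, rfl⟩ | ⟨rfl, rfl⟩ <;> rcases ht with ⟨rfl, rfl⟩ | ⟨rfl, rfl⟩ <;> norm_num
  obtain ⟨p1, p2, p3, p4⟩ := hprod
  have hD' : D = s * t * s' * t' * γ * z + s * t * δ := by
    linear_combination hD - γ * z * (3 * hss + s * s' * htt)
  have e1 := dedekindEta_sq_atkin_lehner (g := 1) (q := s * t) (μ := 1) (ν := s' * t')
    (m := 1) (m' := s * t) (N := N) (D := D) (α := α) (β := β) (γ := γ) (δ := δ)
    one_ne_zero (by lia) (by linear_combination h) hz (by simp) (by simp)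
    (by rw [hN]; push_cast; ring) (by rw [hD']; push_cast; ring)
  have e2 := dedekindEta_sq_atkin_lehner (g := s) (q := t) (μ := s') (ν := t')
    (m := 2) (m' := s' * t) (N := N) (D := D) (α := α) (β := β) (γ := γ) (δ := δ)
    (mod_cast hs0) (by lia) (by linear_combination h) hz hss.symm (by ring)
    hN hD'
  have e3 := dedekindEta_sq_atkin_lehner (g := t) (q := s) (μ := t') (ν := s')
    (m := 3) (m' := s * t') (N := N) (D := D) (α := α) (β := β) (γ := γ) (δ := δ)
    (mod_cast ht0) (by lia) (by linear_combination h) hz htt.symm (by ring)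
    (by rw [hN]; ring) (by rw [hD']; ring)
  have e4 := dedekindEta_sq_atkin_lehner (g := s * t) (q := 1) (μ := s' * t') (ν := 1)
    (m := 6) (m' := s' * t') (N := N) (D := D) (α := α) (β := β) (γ := γ) (δ := δ)
    p1.ne' (by lia) (by linear_combination h) hz
    (by push_cast; linear_combination -3 * hss - s * s' * htt) (by simp)
    (by rw [hN]; push_cast; ring) (by rw [hD']; push_cast; ring)
  have hperm : dedekindEta (s * t * z) ^ 2 * dedekindEta (s' * t * z) ^ 2 *
      dedekindEta (s * t' * z) ^ 2 * dedekindEta (s' * t' * z) ^ 2 = etaProd z := by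
    unfold etaProd
    rcases hs with ⟨rfl, rfl⟩ | ⟨rfl, rfl⟩ <;> rcases ht with ⟨rfl, rfl⟩ | ⟨rfl, rfl⟩ <;>
      norm_num <;> ring
  have hroot := etaSqRoot_zpow_eq (m := _) (n := 0)
    (by simpa using etaSqExponent_atkin_lehner hs ht h)
  rw [zpow_zero, zpow_add₀ etaSqRoot_ne_zero, zpow_add₀ etaSqRoot_ne_zero,
    zpow_add₀ etaSqRoot_ne_zero] at hroot
  simp only [one_mul, Int.cast_one, div_one] at e1 e4
  rw [etaProd, e1, e2, e3, e4, ← hperm]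
  push_cast
  generalize dedekindEta (s * t * z) = x₁, dedekindEta (s' * t * z) = x₂,
    dedekindEta (s * t' * z) = x₃, dedekindEta (s' * t' * z) = x₄
  field_simp
  linear_combination D ^ 4 * x₁ ^ 2 * x₂ ^ 2 * x₃ ^ 2 * x₄ ^ 2 * hroot

/-- `g = η(z)²η(2z)²η(3z)²η(6z)²` is invariant under all Atkin-Lehner involutions `W_Q`,
`Q ∈ {1, 2, 3, 6}`, in weight 4. -/
theorem etaProd_atkin_lehner_invariant :
    ∀ Q ∈ ({1, 2, 3, 6} : Finset ℤ), ∀ W : Matrix (Fin 2) (Fin 2) ℤ,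
      (∃ α β γ δ : ℤ, W = !![Q * α, β; 6 * γ, Q * δ]) → W.det = Q →
      ∀ z : ℂ, 0 < z.im → slash 4 W etaProd z = etaProd z := by
  intro Q hQ W hW hdet z hz
  obtain ⟨α, β, γ, δ, rfl⟩ := hW
  obtain ⟨s, s', t, t', hs, ht, rfl⟩ : ∃ s s' t t' : ℤ, (s = 1 ∧ s' = 2 ∨ s = 2 ∧ s' = 1) ∧
      (t = 1 ∧ t' = 3 ∨ t = 3 ∧ t' = 1) ∧ Q = s * t := by
    simp only [Finset.mem_insert, Finset.mem_singleton] at hQ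
    rcases hQ with rfl | rfl | rfl | rfl
    · exact ⟨1, 2, 1, 3, by simp⟩
    · exact ⟨2, 1, 1, 3, by simp⟩
    · exact ⟨1, 2, 3, 1, by simp⟩
    · exact ⟨2, 1, 3, 1, by simp⟩
  have hst : s * t ≠ 0 := by lia
  have hss : s * s' = 2 := by lia
  have htt : t * t' = 3 := by lia
  have h : s * t * α * δ - s' * t' * β * γ = 1 := by
    rw [Matrix.det_fin_two_of] at hdet
    apply mul_left_cancel₀ hst
    linear_combination hdet - β * γ * (3 * hss + s * s' * htt)
  have hD0 := intCast_mul_add_ne_zero (a := s * t * α) (b := β) (c := 6 * γ) (d := s * t * δ)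
    (by rw [Matrix.det_fin_two_of] at hdet; lia) hz
  have key := etaProd_div_eq hs ht h hz (N := s * t * α * z + β) rfl
    (D := 6 * γ * z + s * t * δ) rfl
  have hst' : (s : ℂ) * t ≠ 0 := mod_cast hst
  push_cast [← mul_assoc] at hD0
  have hpow : ((s * t : ℤ) : ℂ) ^ (((4 : ℤ) : ℂ) / 2) = (s * t) ^ 2 := by
    rw [show ((4 : ℤ) : ℂ) / 2 = (2 : ℕ) by norm_num, Complex.cpow_natCast]
    push_cast
    rfl
  rw [slash, hdet, hpow]
  simp only [Matrix.of_apply, Matrix.cons_val', Matrix.cons_val_zero, Matrix.cons_val_one,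
    Matrix.cons_val_fin_one]
  push_cast [← mul_assoc]
  rw [key, zpow_neg, zpow_ofNat, ← mul_assoc, mul_div_assoc',
    mul_assoc ((_ : ℂ) ^ 2), inv_mul_cancel₀ (pow_ne_zero _ hD0), mul_one,
    div_self (pow_ne_zero _ hst'), one_mul]

end
end
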